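/- Fix n, k : ℕ and q : Fin n. Let H_q be the coordinate hyperplane {v : Fin n → ℂ | v q = 0}, viewed as a Submodule of (Fin n → ℂ), and let e_q be the q-th standard basis vector. Then the assignment sending a pair (L', φ), where L' is a Submodule of (Fin n → ℂ) contained in H_q with finrank ℂ L' = k and φ : L' →ₗ[ℂ] ℂ is a linear functional, to the graph submodule {v + φ(v) • e_q : v ∈ L'}, is a bijection onto the set {L : Submodule ℂ (Fin n → ℂ) | finrank ℂ L = k ∧ e_q ∉ L}. (This identifies the complement E_{1,q} = G_{n,k} \ G_{n−1,k−1}(q) of the k-dimensional subspaces containing e_q with the total space of the canonical vector bundle — the pairs of a k-dimensional subspace of ℂ^{n−1} together with a point of its dual — underlying the torus-equivariant identification of E_{1,q} with ξ_{n−1,k} used to realize G_{n,k}/G_{n−1,k−1}(q) as a Thom space.) -/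

import Mathlib

open Module

theorem graph_aux_le {n : ℕ} (q : Fin n) (A B : Submodule ℂ (Fin n → ℂ))
    (hA : ∀ x ∈ A, x q = 0) (hB : ∀ x ∈ B, x q = 0) (f : A →ₗ[ℂ] ℂ) (g : B →ₗ[ℂ] ℂ)
    (h : LinearMap.range (A.subtype + LinearMap.smulRight f (Pi.single q 1 : Fin n → ℂ)) ≤
      LinearMap.range (B.subtype + LinearMap.smulRight g (Pi.single q 1 : Fin n → ℂ)))
    (x : A) : ∃ y : B, (y : Fin n → ℂ) = x ∧ g y = f x := by
  obtain ⟨y, hy⟩ := h (LinearMap.mem_range_self _ x)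
  have h1 : g y = f x := by
    have := congrFun hy q
    simpa [hA x x.2, hB y y.2] using this
  refine ⟨y, ?_, h1⟩
  simpa [h1] using hy


/-- Fix `q : Fin n`.  Assigning to a pair `(L', φ)` — where `L'` is a `k`-dimensional subspace
of the coordinate hyperplane `H_q = {v | v q = 0}` and `φ : L' → ℂ` is a linear functional —
the graph subspace `{v + φ(v) • e_q : v ∈ L'}` gives a bijection onto the set of
`k`-dimensional subspaces `L ⊆ ℂⁿ` with `e_q ∉ L`.  (This identifies
`E_{1,q} = G_{n,k} \ G_{n-1,k-1}(q)` with the total space of the canonical bundle used to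
realize `G_{n,k}/G_{n-1,k-1}(q)` as a Thom space.) -/
theorem graph_bijection_onto_subspaces_avoiding_eq (n k : ℕ) (q : Fin n) :
    Set.BijOn
      (fun p : Σ L' : {L' : Submodule ℂ (Fin n → ℂ) //
            L' ≤ LinearMap.ker (LinearMap.proj q : (Fin n → ℂ) →ₗ[ℂ] ℂ) ∧
            finrank ℂ L' = k}, (L'.1 →ₗ[ℂ] ℂ) =>
        LinearMap.range (p.1.1.subtype + LinearMap.smulRight p.2 (Pi.single q 1)))
      Set.univ
      {L : Submodule ℂ (Fin n → ℂ) |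
        finrank ℂ L = k ∧ (Pi.single q 1 : Fin n → ℂ) ∉ L} := by
  refine ⟨?_, ?_, ?_⟩
  · rintro ⟨⟨A, hA, hk⟩, f⟩ -
    have hA' : ∀ x : A, (x : Fin n → ℂ) q = 0 := fun x => hA x.2
    refine ⟨?_, ?_⟩
    · dsimp only
      rw [LinearMap.finrank_range_of_inj, hk]
      rw [← LinearMap.ker_eq_bot, LinearMap.ker_eq_bot']
      intro x hx
      have h1 : f x = 0 := by
        have := congrFun hx q
        simpa [hA' x] using this
      simpa [h1] using hx
    · rintro ⟨x, hx⟩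
      have h1 : f x = 1 := by
        have := congrFun hx q
        simpa [hA' x] using this
      have h2 : x = 0 := by simpa [h1] using hx
      simp [h2] at h1
  · rintro ⟨⟨A, hA, hk⟩, f⟩ - ⟨⟨B, hB, hk'⟩, g⟩ - h
    dsimp only at h f g
    have h1 := graph_aux_le q A B (fun x hx => hA hx) (fun x hx => hB hx) f g h.le
    have h2 := graph_aux_le q B A (fun x hx => hB hx) (fun x hx => hA hx) g f h.ge
    have hAB : A = B := by
      apply le_antisymm
      · intro x hx
        obtain ⟨y, hy, -⟩ := h1 ⟨x, hx⟩
        exact (show (y : Fin n → ℂ) = x from hy) ▸ y.2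
      · intro x hx
        obtain ⟨y, hy, -⟩ := h2 ⟨x, hx⟩
        exact (show (y : Fin n → ℂ) = x from hy) ▸ y.2
    subst hAB
    have : f = g := by
      ext x
      obtain ⟨y, hy, e⟩ := h1 x
      rw [← e, Subtype.ext hy]
    subst this
    rfl
  · rintro L ⟨hk, hL⟩
    let e : Fin n → ℂ := Pi.single q 1
    let P : L →ₗ[ℂ] (Fin n → ℂ) :=
      L.subtype - LinearMap.smulRight ((LinearMap.proj q : (Fin n → ℂ) →ₗ[ℂ] ℂ) ∘ₗ L.subtype) e
    have hP : ∀ x : L, P x = (x : Fin n → ℂ) - (x : Fin n → ℂ) q • e := fun x => rfl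
    have hinj : Function.Injective P := by
      rw [← LinearMap.ker_eq_bot, LinearMap.ker_eq_bot']
      intro x hx
      rw [hP, sub_eq_zero] at hx
      by_cases h0 : (x : Fin n → ℂ) q = 0
      · rw [h0, zero_smul] at hx
        exact Subtype.ext hx
      · exfalso
        apply hL
        have := L.smul_mem ((x : Fin n → ℂ) q)⁻¹ x.2
        rw [hx] at this
        have h3 : ((x : Fin n → ℂ) q)⁻¹ • ((x : Fin n → ℂ) q) • e ∈ L := by
          have := L.smul_mem ((x : Fin n → ℂ) q)⁻¹ x.2
          exact hx ▸ this
        rwa [inv_smul_smul₀ h0] at h3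
    let E := LinearEquiv.ofInjective P hinj
    refine ⟨⟨⟨LinearMap.range P, ?_, ?_⟩,
      ((LinearMap.proj q : (Fin n → ℂ) →ₗ[ℂ] ℂ) ∘ₗ L.subtype) ∘ₗ E.symm.toLinearMap⟩,
      Set.mem_univ _, ?_⟩
    · rintro _ ⟨x, rfl⟩
      simp [hP, e]
    · rw [LinearMap.finrank_range_of_inj hinj, hk]
    · have key : ∀ x : L, ((LinearMap.range P).subtype + LinearMap.smulRight
          (((LinearMap.proj q : (Fin n → ℂ) →ₗ[ℂ] ℂ) ∘ₗ L.subtype) ∘ₗ E.symm.toLinearMap) e)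
          (E x) = x := by
        intro x
        have hE : ((E x : LinearMap.range P) : Fin n → ℂ) = P x := rfl
        simp [hE, hP]
      ext v
      constructor
      · rintro ⟨y, rfl⟩
        obtain ⟨x, rfl⟩ := E.surjective y
        exact (key x).symm ▸ x.2
      · intro hv
        exact ⟨E ⟨v, hv⟩, key ⟨v, hv⟩⟩
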